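/- Fix n ≥ 2. Let Art(Ã_n) be the group presented by generators t_i indexed by i ∈ ℤ/(n+1) with relations: t_it_{i+1}t_i = t_{i+1}t_it_{i+1} for each i ∈ ℤ/(n+1), and t_it_j = t_jt_i whenever j ≠ i ± 1 in ℤ/(n+1). Then the center of Art(Ã_n) is trivial. -/

import Mathlib

/-- The standard presentation relations for the euclidean Artin group `Art(Ã_n)`
on generators `t_i`, `i ∈ ℤ/(n+1)`:  `t_it_{i+1}t_i = t_{i+1}t_it_{i+1}` for each
`i`, and `t_it_j = t_jt_i` whenever `j ≠ i ± 1`. -/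
def relsArtinAtilde (n : ℕ) : Set (FreeGroup (ZMod (n + 1))) :=
  {x | ∃ i : ZMod (n + 1),
      x = FreeGroup.of i * FreeGroup.of (i + 1) * FreeGroup.of i *
        (FreeGroup.of (i + 1) * FreeGroup.of i * FreeGroup.of (i + 1))⁻¹} ∪
  {x | ∃ i j : ZMod (n + 1), j ≠ i + 1 ∧ j ≠ i - 1 ∧
      x = FreeGroup.of i * FreeGroup.of j * (FreeGroup.of j * FreeGroup.of i)⁻¹}

theorem SemiconjBy.commute_of_commute {E : Type*} [Group E] {w a b a' b' : E}
    (ha : SemiconjBy w a a') (hb : SemiconjBy w b b') (h : Commute a' b') : Commute a b := by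
  have ea : a = w⁻¹ * a' * w := by rw [mul_assoc, ← ha.eq]; group
  have eb : b = w⁻¹ * b' * w := by rw [mul_assoc, ← hb.eq]; group
  rw [ea, eb, commute_iff_eq]
  calc w⁻¹ * a' * w * (w⁻¹ * b' * w) = w⁻¹ * (a' * b') * w := by group
    _ = w⁻¹ * (b' * a') * w := by rw [h.eq]
    _ = _ := by group

/-- The first `M` members of the sequence `e` satisfy the braid relations. -/
structure BraidRel {E : Type*} [Group E] (e : ℕ → E) (M : ℕ) : Prop where
  braid : ∀ i, i + 1 < M → e i * e (i + 1) * e i = e (i + 1) * e i * e (i + 1)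
  comm : ∀ i j, i + 2 ≤ j → j < M → Commute (e i) (e j)

/-- The element `τ p`, together with the braid generators `e p, …, e (M - 1)`, satisfies
the relations of the Artin group of type `B`, and `τ (p + 1), …, τ M` are its
successive conjugates. -/
structure TypeB {E : Type*} [Group E] (e τ : ℕ → E) (M p : ℕ) : Prop extends BraidRel e M where
  step : ∀ j, p ≤ j → j < M → SemiconjBy (e j) (τ (j + 1)) (τ j)
  comm_base : ∀ i, p < i → i < M → Commute (e i) (τ p)
  rel_base : p < M → Commute (τ p) (e p * τ p * e p)

namespace BraidRel

variable {E : Type*} [Group E] {e : ℕ → E} {M : ℕ}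

theorem semiconj (h : BraidRel e M) {i : ℕ} (hi : i + 1 < M) :
    SemiconjBy (e i * e (i + 1)) (e i) (e (i + 1)) := by
  rw [SemiconjBy, h.braid i hi, mul_assoc]

theorem semiconj' (h : BraidRel e M) {i : ℕ} (hi : i + 1 < M) :
    SemiconjBy (e (i + 1) * e i) (e (i + 1)) (e i) := by
  rw [SemiconjBy, ← h.braid i hi, mul_assoc]

end BraidRel

namespace TypeB

variable {E : Type*} [Group E] {e τ : ℕ → E} {M p : ℕ}

theorem commute_of_lt (h : TypeB e τ M p) {i j : ℕ} (hj : p ≤ j) (hji : j < i) (hi : i < M) :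
    Commute (e i) (τ j) := by
  induction j, hj using Nat.le_induction with
  | base => exact h.comm_base i hji hi
  | succ j hj ih =>
    have h1 := ih (by omega)
    have h2 : Commute (e j) (e i) := h.comm j i (by omega) hi
    exact SemiconjBy.commute_of_commute h2 (h.step j hj (by omega)) h1

theorem commute_of_gt (h : TypeB e τ M p) {i j : ℕ} (hi : p ≤ i) (hij : i + 2 ≤ j) (hj : j ≤ M) :
    Commute (e i) (τ j) := by
  induction j, hij using Nat.le_induction with
  | base =>
    refine SemiconjBy.commute_of_commute (h.semiconj (i := i) (by omega)) ?_
      (h.commute_of_lt hi (Nat.lt_succ_self i) (by omega))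
    exact (h.step i hi (by omega)).mul_left (h.step (i + 1) (by omega) (by omega))
  | succ j hij ih =>
    have h2 : Commute (e j) (e i) := (h.comm i j (by omega) (by omega)).symm
    exact SemiconjBy.commute_of_commute h2 (h.step j (by omega) (by omega)) (ih (by omega))

theorem rel (h : TypeB e τ M p) {j : ℕ} (hj : p ≤ j) (hjM : j < M) :
    Commute (τ j) (e j * τ j * e j) := by
  induction j, hj using Nat.le_induction with
  | base => exact h.rel_base hjM
  | succ j hj ih =>
    have h1 := h.semiconj' (i := j) hjM
    have h2 : SemiconjBy (e (j + 1) * e j) (τ (j + 1)) (τ j) := by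
      have h3 : SemiconjBy (e (j + 1)) (τ j) (τ j) := h.commute_of_lt hj (Nat.lt_succ_self j) hjM
      exact h3.mul_left (h.step j hj (by omega))
    exact SemiconjBy.commute_of_commute h2 ((h1.mul_right h2).mul_right h1) (ih (by omega))

/-- The conjugates `τ p, …, τ M` of a type `B` element generate a subgroup normalized by
the braid generators. -/
theorem closure_le_normalizer (h : TypeB e τ M p) :
    Subgroup.closure (e '' Set.Ico p M) ≤
      Subgroup.normalizer (Subgroup.closure (τ '' Set.Icc p M) : Set E) := by
  set U := Subgroup.closure (τ '' Set.Icc p M) with hU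
  have mem : ∀ j, p ≤ j → j ≤ M → τ j ∈ U := fun j h1 h2 =>
    Subgroup.subset_closure ⟨j, ⟨h1, h2⟩, rfl⟩
  have main : ∀ i, p ≤ i → i < M → ∀ j, p ≤ j → j ≤ M →
      e i * τ j * (e i)⁻¹ ∈ U ∧ (e i)⁻¹ * τ j * e i ∈ U := by
    intro i hi hiM j hj hjM
    have hs := (h.step i hi hiM).eq
    have hr := (h.rel hi hiM).eq
    have hi0 := mem i hi hiM.le
    have hi1 := mem (i + 1) (by omega) hiM
    have e1 : τ i = e i * τ (i + 1) * (e i)⁻¹ := by rw [hs]; group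
    have e2 : e i * τ i * (e i)⁻¹ = (τ i)⁻¹ * τ (i + 1) * τ i := by
      have e3 : τ (i + 1) = (e i)⁻¹ * τ i * e i := by rw [mul_assoc, ← hs]; group
      rw [e3]
      calc e i * τ i * (e i)⁻¹
          = (τ i)⁻¹ * (e i)⁻¹ * (e i * τ i * e i * τ i) * (e i)⁻¹ := by group
        _ = _ := by rw [← hr]; group
    have e3 : (e i)⁻¹ * τ (i + 1) * e i = τ (i + 1) * τ i * (τ (i + 1))⁻¹ := by
      have e4 : τ (i + 1) = (e i)⁻¹ * τ i * e i := by rw [mul_assoc, ← hs]; group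
      rw [e4]
      calc (e i)⁻¹ * ((e i)⁻¹ * τ i * e i) * e i
          = (e i)⁻¹ * (e i)⁻¹ * (τ i * (e i * τ i * e i)) * (e i)⁻¹ * (τ i)⁻¹ * e i := by group
        _ = _ := by rw [hr]; group
    have hc : Commute (e i) (τ j) → e i * τ j * (e i)⁻¹ ∈ U ∧ (e i)⁻¹ * τ j * e i ∈ U := by
      intro hc
      rw [hc.eq, mul_inv_cancel_right, mul_assoc, ← hc.eq, inv_mul_cancel_left]
      exact ⟨mem j hj hjM, mem j hj hjM⟩
    rcases lt_trichotomy j i with hlt | rfl | hgt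
    · exact hc (h.commute_of_lt hj hlt hiM)
    · refine ⟨?_, ?_⟩
      · rw [e2]
        exact U.mul_mem (U.mul_mem (U.inv_mem hi0) hi1) hi0
      · rw [mul_assoc, ← hs, inv_mul_cancel_left]
        exact hi1
    · rcases Nat.eq_or_lt_of_le (Nat.succ_le_of_lt hgt) with rfl | hgt'
      · refine ⟨?_, ?_⟩
        · rw [Nat.succ_eq_add_one, ← e1]
          exact hi0
        · rw [Nat.succ_eq_add_one, e3]
          exact U.mul_mem (U.mul_mem hi1 hi0) (U.inv_mem hi1)
      · exact hc (h.commute_of_gt hi hgt' hjM)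
  rw [Subgroup.closure_le]
  rintro _ ⟨i, ⟨hi, hiM⟩, rfl⟩
  rw [SetLike.mem_coe, Subgroup.mem_normalizer_iff_map_conj_eq]
  apply le_antisymm
  · rw [hU, MonoidHom.map_closure, Subgroup.closure_le]
    rintro _ ⟨_, ⟨j, ⟨hj, hjM⟩, rfl⟩, rfl⟩
    exact (main i hi hiM j hj hjM).1
  · conv_lhs => rw [hU]
    rw [Subgroup.closure_le]
    rintro _ ⟨j, ⟨hj, hjM⟩, rfl⟩
    exact ⟨_, (main i hi hiM j hj hjM).2, by simp [mul_assoc]⟩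

/-- Every element of the subgroup generated by a type `B` family is a product of an element
of the subgroup generated by the conjugates `τ j` and a braid. -/
theorem exists_mul_of_mem_sup (h : TypeB e τ M p) {x : E}
    (hx : x ∈ Subgroup.closure (τ '' Set.Icc p M) ⊔ Subgroup.closure (e '' Set.Ico p M)) :
    ∃ f ∈ Subgroup.closure (FreeGroup.of '' Set.Icc p M),
      ∃ d ∈ Subgroup.closure (e '' Set.Ico p M), x = FreeGroup.lift τ f * d := by
  rw [← SetLike.mem_coe, Subgroup.coe_mul_of_right_le_normalizer_left _ _ h.closure_le_normalizer]
    at hx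
  obtain ⟨u, hu, d, hd, rfl⟩ := hx
  have : Subgroup.closure (τ '' Set.Icc p M) =
      (Subgroup.closure (FreeGroup.of '' Set.Icc p M)).map (FreeGroup.lift τ) := by
    rw [MonoidHom.map_closure, Set.image_image]
    simp
  rw [this] at hu
  obtain ⟨f, hf, rfl⟩ := hu
  exact ⟨f, hf, d, hd, rfl⟩

end TypeB

theorem FreeGroup.exists_zpow_of_commute {α : Type*} {a b : FreeGroup α} (h : Commute a b) :
    ∃ (r : FreeGroup α) (k l : ℤ), a = r ^ k ∧ b = r ^ l := by
  let H := Subgroup.closure ({a, b} : Set (FreeGroup α))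
  have hcomm : ∀ x y : H, x * y = y * x := by
    have := Subgroup.isMulCommutative_closure (k := ({a, b} : Set (FreeGroup α))) (by
      rintro x (rfl | rfl) y (rfl | rfl)
      exacts [rfl, h.eq, h.eq.symm, rfl])
    exact this.is_comm.comm
  have hsub : Subsingleton (IsFreeGroup.Generators H) := by
    refine ⟨fun x y => ?_⟩
    by_contra hxy
    have h1 : FreeGroup.of x * FreeGroup.of y = FreeGroup.of y * FreeGroup.of x := by
      apply (IsFreeGroup.mulEquiv H).injective
      rw [MulEquiv.map_mul, MulEquiv.map_mul, hcomm]
    classical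
    have h2 := congrArg FreeGroup.toWord h1
    simp [FreeGroup.toWord_mul, FreeGroup.reduce.cons, FreeGroup.toWord_of] at h2
    exact hxy h2.1
  have hcyc : IsCyclic H := by
    have : IsCyclic (FreeGroup (IsFreeGroup.Generators H)) := by
      rcases isEmpty_or_nonempty (IsFreeGroup.Generators H) with he | ⟨⟨x⟩⟩
      · infer_instance
      · have := uniqueOfSubsingleton x
        infer_instance
    exact isCyclic_of_surjective _ (IsFreeGroup.mulEquiv H).surjective
  obtain ⟨r, hr⟩ := hcyc.exists_generator
  obtain ⟨k, hk⟩ := hr ⟨a, Subgroup.subset_closure (by simp)⟩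
  obtain ⟨l, hl⟩ := hr ⟨b, Subgroup.subset_closure (by simp)⟩
  exact ⟨r, k, l, by simpa using (congrArg Subtype.val hk).symm,
    by simpa using (congrArg Subtype.val hl).symm⟩

/-- Two commuting elements of a free group: if a homomorphism to a torsion-free group kills one of
them, which is nontrivial in another torsion-free quotient, then it kills the other. -/
theorem FreeGroup.map_eq_one_of_commute {α A : Type*} [Group A] [IsMulTorsionFree A]
    {a b : FreeGroup α} (h : Commute a b) (hb : b ≠ 1) (f : FreeGroup α →* A) (hf : f b = 1) :
    f a = 1 := by
  obtain ⟨r, k, l, rfl, rfl⟩ := FreeGroup.exists_zpow_of_commute h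
  have hl : l ≠ 0 := by rintro rfl; simp at hb
  rw [map_zpow] at hf ⊢
  have : f r = 1 := by
    by_contra hne
    exact hl (by simpa [hne] using hf)
  rw [this, one_zpow]

/-- The Hurwitz automorphism of the free group given by the `i`-th braid generator. -/
def artinAut (i : ℕ) : MulAut (FreeGroup ℕ) :=
  MonoidHom.toMulEquiv
    (FreeGroup.lift fun j => if j = i then
      (FreeGroup.of i)⁻¹ * FreeGroup.of (i + 1) * FreeGroup.of i
      else if j = i + 1 then FreeGroup.of i else FreeGroup.of j)
    (FreeGroup.lift fun j => if j = i then FreeGroup.of (i + 1)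
      else if j = i + 1 then FreeGroup.of (i + 1) * FreeGroup.of i * (FreeGroup.of (i + 1))⁻¹
      else FreeGroup.of j)
    (by
      ext j
      by_cases h1 : j = i
      · simp [h1, mul_assoc]
      by_cases h2 : j = i + 1
      · simp [h2]
      · simp [h1, h2])
    (by
      ext j
      by_cases h1 : j = i
      · simp [h1]
      by_cases h2 : j = i + 1
      · simp [h2, mul_assoc]
      · simp [h1, h2])

@[simp]
theorem artinAut_of_self (i : ℕ) : artinAut i (FreeGroup.of i) =
    (FreeGroup.of i)⁻¹ * FreeGroup.of (i + 1) * FreeGroup.of i := by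
  simp [artinAut]

@[simp]
theorem artinAut_of_succ (i : ℕ) : artinAut i (FreeGroup.of (i + 1)) = FreeGroup.of i := by
  simp [artinAut]

theorem artinAut_of_of_ne {i j : ℕ} (h1 : j ≠ i) (h2 : j ≠ i + 1) :
    artinAut i (FreeGroup.of j) = FreeGroup.of j := by
  simp [artinAut, h1, h2]

theorem MulAut.freeGroup_ext {α : Type*} {φ ψ : MulAut (FreeGroup α)}
    (h : ∀ j, φ (FreeGroup.of j) = ψ (FreeGroup.of j)) : φ = ψ := by
  have : φ.toMonoidHom = ψ.toMonoidHom := FreeGroup.ext_hom _ _ h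
  ext x
  exact DFunLike.congr_fun this x

theorem artinAut_braidRel (M : ℕ) : BraidRel artinAut M where
  braid i _ := by
    refine MulAut.freeGroup_ext fun j => ?_
    have a1 : artinAut i (FreeGroup.of (i + 1 + 1)) = FreeGroup.of (i + 1 + 1) :=
      artinAut_of_of_ne (by omega) (by omega)
    have a2 : artinAut (i + 1) (FreeGroup.of i) = FreeGroup.of i :=
      artinAut_of_of_ne (by omega) (by omega)
    by_cases h1 : j = i
    · subst h1
      simp [a1, a2, mul_assoc]
    by_cases h2 : j = i + 1
    · subst h2
      simp [a1, a2, mul_assoc]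
    by_cases h3 : j = i + 1 + 1
    · subst h3
      simp [a1, a2, mul_assoc]
    simp [artinAut_of_of_ne, h1, h2, h3]
  comm i j hij _ := by
    refine MulAut.freeGroup_ext fun k => ?_
    have a1 : artinAut i (FreeGroup.of j) = FreeGroup.of j :=
      artinAut_of_of_ne (by omega) (by omega)
    have a2 : artinAut i (FreeGroup.of (j + 1)) = FreeGroup.of (j + 1) :=
      artinAut_of_of_ne (by omega) (by omega)
    have a3 : artinAut j (FreeGroup.of i) = FreeGroup.of i :=
      artinAut_of_of_ne (by omega) (by omega)
    have a4 : artinAut j (FreeGroup.of (i + 1)) = FreeGroup.of (i + 1) :=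
      artinAut_of_of_ne (by omega) (by omega)
    by_cases h1 : k = i
    · subst h1
      simp [a3, a4]
    by_cases h2 : k = i + 1
    · subst h2
      simp [a3, a4]
    by_cases h3 : k = j
    · subst h3
      simp [a1, a2]
    by_cases h4 : k = j + 1
    · subst h4
      simp [a1, a2]
    simp [artinAut_of_of_ne, h1, h2, h3, h4]

section ProdFrom

variable {E : Type*} [Group E] (e : ℕ → E) (p : ℕ)

/-- The product `e p * e (p + 1) * ⋯ * e (j - 1)`. -/
def prodFrom : ℕ → E
  | 0 => 1
  | j + 1 => if p ≤ j then prodFrom j * e j else 1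

@[simp]
theorem prodFrom_self : prodFrom e p p = 1 := by
  cases p <;> simp [prodFrom]

variable {p} in
theorem prodFrom_succ {j : ℕ} (h : p ≤ j) : prodFrom e p (j + 1) = prodFrom e p j * e j := by
  simp [prodFrom, h]

variable {e p}

theorem prodFrom_mem {M j : ℕ} (hj : p ≤ j) (hjM : j ≤ M) :
    prodFrom e p j ∈ Subgroup.closure (e '' Set.Ico p M) := by
  induction j, hj using Nat.le_induction with
  | base => simp
  | succ j hj ih =>
    rw [prodFrom_succ e hj]
    exact Subgroup.mul_mem _ (ih (by omega)) (Subgroup.subset_closure ⟨j, ⟨hj, hjM⟩, rfl⟩)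

namespace BraidRel

variable {M : ℕ}

theorem commute_prodFrom (h : BraidRel e M) {i k : ℕ} (hk : p ≤ k) (hki : k < i) (hi : i < M) :
    Commute (prodFrom e p k) (e i) := by
  induction k, hk using Nat.le_induction with
  | base => simp
  | succ k hk ih =>
    rw [prodFrom_succ e hk]
    exact (ih (by omega)).mul_left (h.comm k i (by omega) hi)

theorem semiconj_prodFrom (h : BraidRel e M) {i k : ℕ} (hi : p ≤ i) (hik : i + 2 ≤ k)
    (hk : k ≤ M) : SemiconjBy (prodFrom e p k) (e i) (e (i + 1)) := by
  induction k, hik using Nat.le_induction with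
  | base =>
    rw [prodFrom_succ e (by omega), prodFrom_succ e hi, mul_assoc]
    exact SemiconjBy.mul_left (h.commute_prodFrom hi (Nat.lt_succ_self i) (by omega))
      (h.semiconj (by omega))
  | succ k hik ih =>
    rw [prodFrom_succ e (by omega)]
    exact SemiconjBy.mul_left (ih (by omega)) (h.comm i k (by omega) (by omega)).symm

/-- The type `B` family obtained from an element by successive conjugation. -/
theorem typeB_conj (h : BraidRel e M) {t : E} (hc : ∀ i, p < i → i < M → Commute (e i) t)
    (hr : p < M → Commute t (e p * t * e p)) :
    TypeB e (fun j => (prodFrom e p j)⁻¹ * t * prodFrom e p j) M p where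
  toBraidRel := h
  step j hj _ := by
    simp only [SemiconjBy]
    rw [prodFrom_succ e hj]
    group
  comm_base i hi hiM := by simpa using hc i hi hiM
  rel_base hp := by simpa using hr hp

end BraidRel

theorem TypeB.semiconj_sq {τ : ℕ → E} {M : ℕ} (h : TypeB e τ M (p + 1)) (hτ : τ (p + 1) = e p * e p)
    {k : ℕ} (hk : p ≤ k) (hkM : k < M) :
    SemiconjBy (prodFrom e p k) (e k * e k) (τ (k + 1)) := by
  induction k, hk using Nat.le_induction with
  | base => simp [hτ]
  | succ k hk ih =>
    have h1 := h.semiconj' (i := k) hkM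
    have h2 := (ih (by omega)).mul_left (h1.mul_right h1)
    rw [← mul_assoc, (h.commute_prodFrom hk (Nat.lt_succ_self k) hkM).eq, mul_assoc,
      ← prodFrom_succ e hk] at h2
    have h3 := h.step (k + 1) (by omega) hkM
    have h4 := h2.eq
    rw [SemiconjBy]
    apply mul_left_cancel (a := e (k + 1))
    rw [← mul_assoc, h4, ← mul_assoc, ← mul_assoc, h3.eq]

/-- Right coset representatives for the stabilizer of a strand in the braid group. -/
theorem TypeB.exists_coset {τ : ℕ → E} {M : ℕ} (h : TypeB e τ M (p + 1))
    (hτ : τ (p + 1) = e p * e p) (hpM : p ≤ M) {x : E}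
    (hx : x ∈ Subgroup.closure (e '' Set.Ico p M)) :
    ∃ k, p ≤ k ∧ k ≤ M ∧ ∃ y ∈ Subgroup.closure (τ '' Set.Icc (p + 1) M) ⊔
      Subgroup.closure (e '' Set.Ico (p + 1) M), x = y * prodFrom e p k := by
  set H := Subgroup.closure (τ '' Set.Icc (p + 1) M) ⊔
      Subgroup.closure (e '' Set.Ico (p + 1) M) with hH
  have he : ∀ i, p + 1 ≤ i → i < M → e i ∈ H := fun i h1 h2 =>
    (le_sup_right : _ ≤ H) (Subgroup.subset_closure ⟨i, ⟨h1, h2⟩, rfl⟩)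
  have ht : ∀ i, p + 1 ≤ i → i ≤ M → τ i ∈ H := fun i h1 h2 =>
    (le_sup_left : _ ≤ H) (Subgroup.subset_closure ⟨i, ⟨h1, h2⟩, rfl⟩)
  have key : ∀ k, p ≤ k → k ≤ M → ∀ i, p ≤ i → i < M →
      (∃ k', p ≤ k' ∧ k' ≤ M ∧ ∃ y ∈ H, prodFrom e p k * e i = y * prodFrom e p k') ∧
      (∃ k', p ≤ k' ∧ k' ≤ M ∧ ∃ y ∈ H, prodFrom e p k * (e i)⁻¹ = y * prodFrom e p k') := by
    intro k hk hkM i hi hiM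
    rcases lt_trichotomy i k with hik | rfl | hki
    · rcases Nat.eq_or_lt_of_le (Nat.succ_le_of_lt hik) with rfl | hik'
      · have hs := (h.semiconj_sq hτ hi hiM).eq
        have hr := prodFrom_succ e hi
        refine ⟨⟨i, hi, hiM.le, τ (i + 1), ht _ (by omega) hkM, ?_⟩,
          ⟨i, hi, hiM.le, 1, one_mem _, ?_⟩⟩
        · rw [Nat.succ_eq_add_one, hr, mul_assoc, hs]
        · rw [Nat.succ_eq_add_one, hr, mul_inv_cancel_right, one_mul]
      · have hs := h.semiconj_prodFrom hi hik' hkM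
        exact ⟨⟨k, hk, hkM, _, he (i + 1) (by omega) (by omega), hs.eq⟩,
          ⟨k, hk, hkM, _, inv_mem (he (i + 1) (by omega) (by omega)), hs.inv_right.eq⟩⟩
    · have hs := (h.semiconj_sq hτ hi hiM).inv_right.eq
      have hr := prodFrom_succ e hi
      refine ⟨⟨i + 1, by omega, by omega, 1, one_mem _, ?_⟩,
          ⟨i + 1, by omega, by omega, (τ (i + 1))⁻¹, inv_mem (ht _ (by omega) (by omega)), ?_⟩⟩
      · rw [one_mul, hr]
      · rw [hr, ← mul_assoc, ← hs]
        group
    · have hs : SemiconjBy _ _ _ := h.commute_prodFrom hk hki hiM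
      exact ⟨⟨k, hk, hkM, _, he i (by omega) hiM, hs.eq⟩,
        ⟨k, hk, hkM, _, inv_mem (he i (by omega) hiM), hs.inv_right.eq⟩⟩
  induction hx using Subgroup.closure_induction_right with
  | one => exact ⟨p, le_rfl, hpM, 1, one_mem _, by simp⟩
  | mul_right x hx y hy ih =>
    obtain ⟨k, hk, hkM, z, hz, rfl⟩ := ih
    obtain ⟨i, ⟨hi, hiM⟩, rfl⟩ := hy
    obtain ⟨k', hk', hkM', z', hz', h'⟩ := (key k hk hkM i hi hiM).1
    exact ⟨k', hk', hkM', z * z', mul_mem hz hz', by rw [mul_assoc, h', mul_assoc]⟩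
  | mul_inv_cancel x hx y hy ih =>
    obtain ⟨k, hk, hkM, z, hz, rfl⟩ := ih
    obtain ⟨i, ⟨hi, hiM⟩, rfl⟩ := hy
    obtain ⟨k', hk', hkM', z', hz', h'⟩ := (key k hk hkM i hi hiM).2
    exact ⟨k', hk', hkM', z * z', mul_mem hz hz', by rw [mul_assoc, h', mul_assoc]⟩

end ProdFrom

section Faithful

/-- The endomorphism of the free group killing the generator `p`. -/
def killGen (p : ℕ) : FreeGroup ℕ →* FreeGroup ℕ :=
  FreeGroup.lift fun j => if j = p then 1 else FreeGroup.of j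

theorem killGen_of_self (p : ℕ) : killGen p (FreeGroup.of p) = 1 := by simp [killGen]

theorem killGen_of_ne {p j : ℕ} (h : j ≠ p) : killGen p (FreeGroup.of j) = FreeGroup.of j := by
  simp [killGen, h]

theorem killGen_artinAut {p j : ℕ} (h : p < j) (y : FreeGroup ℕ) :
    killGen p (artinAut j y) = artinAut j (killGen p y) := by
  have : (killGen p).comp (artinAut j).toMonoidHom = (artinAut j).toMonoidHom.comp (killGen p) := by
    refine FreeGroup.ext_hom _ _ fun k => ?_
    have a1 : killGen p (FreeGroup.of j) = FreeGroup.of j := killGen_of_ne (by omega)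
    have a2 : killGen p (FreeGroup.of (j + 1)) = FreeGroup.of (j + 1) := killGen_of_ne (by omega)
    by_cases h1 : k = j
    · subst h1; simp [a1, a2]
    by_cases h2 : k = j + 1
    · subst h2; simp [a1, a2]
    by_cases h3 : k = p
    · subst h3; simp [artinAut_of_of_ne h1 h2, killGen_of_self]
    · simp [artinAut_of_of_ne h1 h2, killGen_of_ne h3]
  exact DFunLike.congr_fun this y

theorem killGen_artinAut_sq (p : ℕ) (y : FreeGroup ℕ) :
    killGen p (artinAut p (artinAut p y)) = killGen p y := by
  have : (killGen p).comp (artinAut p * artinAut p).toMonoidHom = killGen p := by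
    refine FreeGroup.ext_hom _ _ fun k => ?_
    by_cases h1 : k = p
    · subst h1; simp [killGen_of_self]
    by_cases h2 : k = p + 1
    · subst h2; simp [killGen_of_self]
    · simp [artinAut_of_of_ne h1 h2]
  exact DFunLike.congr_fun this y

variable {E : Type*} [Group E] {e τ : ℕ → E} {M p : ℕ} {π : E →* MulAut (FreeGroup ℕ)}

/-- Pushing the strand `p` along a loop `f` conjugates the generator `p` by an element that
becomes `f⁻¹` once the generator `p` is killed. -/
theorem TypeB.exists_conj (h : TypeB e τ M (p + 1)) (hτ : τ (p + 1) = e p * e p)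
    (hπ : ∀ i < M, π (e i) = artinAut i) (hpM : p < M) {f : FreeGroup ℕ}
    (hf : f ∈ Subgroup.closure (FreeGroup.of '' Set.Icc (p + 1) M)) :
    (∃ w, π (FreeGroup.lift τ f) (FreeGroup.of p) = w * FreeGroup.of p * w⁻¹ ∧
      killGen p w = f⁻¹) ∧ ∀ y, killGen p (π (FreeGroup.lift τ f) y) = killGen p y := by
  induction hf using Subgroup.closure_induction with
  | mem x hx =>
    obtain ⟨j, ⟨hj, hjM⟩, rfl⟩ := hx
    rw [FreeGroup.lift_apply_of]
    induction j, hj using Nat.le_induction with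
    | base =>
      simp only [hτ, map_mul, hπ p hpM, MulAut.mul_apply]
      refine ⟨⟨(FreeGroup.of p)⁻¹ * (FreeGroup.of (p + 1))⁻¹, ?_, ?_⟩, killGen_artinAut_sq p⟩
      · simp [mul_assoc]
      · simp [killGen_of_self, killGen_of_ne]
    | succ j hj ih =>
      obtain ⟨⟨w, hw, hkw⟩, hk⟩ := ih (by omega)
      have hs : τ (j + 1) = (e j)⁻¹ * τ j * e j := by
        rw [mul_assoc, ← (h.step j hj (by omega)).eq, inv_mul_cancel_left]
      have hfix : artinAut j (FreeGroup.of p) = FreeGroup.of p :=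
        artinAut_of_of_ne (by omega) (by omega)
      have hinv : ∀ y, killGen p ((artinAut j)⁻¹ y) = (artinAut j)⁻¹ (killGen p y) := by
        intro y
        apply (artinAut j).injective
        rw [← killGen_artinAut (by omega)]
        simp
      simp only [hs, map_mul, map_inv, hπ j (by omega), MulAut.mul_apply, hfix, hw]
      refine ⟨⟨(artinAut j)⁻¹ w, ?_, ?_⟩, ?_⟩
      · have : (artinAut j)⁻¹ (FreeGroup.of p) = FreeGroup.of p := by
          apply (artinAut j).injective
          simp [hfix]
        rw [this]
      · rw [hinv, hkw]
        apply (artinAut j).injective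
        simp
      · intro y
        rw [hinv, hk, killGen_artinAut (by omega)]
        simp
  | one => exact ⟨⟨1, by simp⟩, by simp⟩
  | mul f g hf hg ihf ihg =>
    obtain ⟨⟨w, hw, hkw⟩, hk⟩ := ihf
    obtain ⟨⟨v, hv, hkv⟩, hk'⟩ := ihg
    refine ⟨⟨π (FreeGroup.lift τ f) v * w, ?_, ?_⟩, ?_⟩
    · simp only [map_mul, map_inv, MulAut.mul_apply, hv, hw]
      group
    · rw [map_mul, hk, hkv, hkw, mul_inv_rev]
    · intro y
      simp only [map_mul, MulAut.mul_apply]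
      rw [hk, hk']
  | inv f hf ih =>
    obtain ⟨⟨w, hw, hkw⟩, hk⟩ := ih
    set φ := π (FreeGroup.lift τ f) with hφ
    have hk' : ∀ y, killGen p (φ⁻¹ y) = killGen p y := by
      intro y
      rw [← hk]
      simp
    rw [map_inv, map_inv, ← hφ]
    refine ⟨⟨(φ⁻¹ w)⁻¹, ?_, ?_⟩, hk'⟩
    · apply φ.injective
      simp [hw, mul_assoc]
    · rw [map_inv, hk', hkw]

theorem fixes_of_mem_closure (hπ : ∀ i < M, π (e i) = artinAut i) {q j : ℕ}
    (hj : j < q ∨ M < j) {d : E}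
    (hd : d ∈ Subgroup.closure (e '' Set.Ico q M)) : π d (FreeGroup.of j) = FreeGroup.of j := by
  have : Subgroup.closure (e '' Set.Ico q M) ≤
      (MulAction.stabilizer (MulAut (FreeGroup ℕ)) (FreeGroup.of j)).comap π := by
    rw [Subgroup.closure_le]
    rintro _ ⟨i, ⟨hi, hiM⟩, rfl⟩
    simp only [Subgroup.coe_comap, Set.mem_preimage, SetLike.mem_coe, MulAction.mem_stabilizer_iff,
      hπ i hiM]
    exact artinAut_of_of_ne (by omega) (by omega)
  exact this hd

theorem map_prodFrom_of (hπ : ∀ i < M, π (e i) = artinAut i) {k : ℕ} (hk : p ≤ k) (hkM : k ≤ M) :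
    π (prodFrom e p k) (FreeGroup.of k) = FreeGroup.of p := by
  induction k, hk using Nat.le_induction with
  | base => simp
  | succ k hk ih =>
    rw [prodFrom_succ e hk, map_mul, MulAut.mul_apply, hπ k (by omega), artinAut_of_succ,
      ih (by omega)]

/-- Artin's theorem: the braid group acts faithfully on the free group. -/
theorem BraidRel.faithful (h : BraidRel e M) (hπ : ∀ i < M, π (e i) = artinAut i)
    (hp : p ≤ M) {x : E} (hx : x ∈ Subgroup.closure (e '' Set.Ico p M)) (hx1 : π x = 1) :
    x = 1 := by
  induction hp using Nat.decreasingInduction generalizing x with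
  | self => simpa using hx
  | of_succ p hpM ih =>
    have hB : TypeB e (fun j => (prodFrom e (p + 1) j)⁻¹ * (e p * e p) * prodFrom e (p + 1) j)
        M (p + 1) := by
      refine h.typeB_conj ?_ ?_
      · intro i hi hiM
        have := (h.comm p i hi hiM).symm
        exact this.mul_right this
      · intro hp
        have hc : SemiconjBy (e (p + 1) * e p * (e p * e (p + 1))) (e p) (e p) :=
          (h.semiconj' hp).mul_left (h.semiconj hp)
        have hc' : Commute (e (p + 1) * (e p * e p) * e (p + 1)) (e p) := by
          rwa [← mul_assoc, mul_assoc (e (p + 1))] at hc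
        exact (hc'.mul_right hc').symm
    set τ := (fun j => (prodFrom e (p + 1) j)⁻¹ * (e p * e p) * prodFrom e (p + 1) j) with hτdef
    have hτ : τ (p + 1) = e p * e p := by simp [hτdef]
    obtain ⟨k, hk, hkM, y, hy, rfl⟩ := hB.exists_coset hτ hpM.le hx
    obtain ⟨f, hf, d, hd, rfl⟩ := hB.exists_mul_of_mem_sup hy
    obtain ⟨⟨w, hw, hkw⟩, hkill⟩ := hB.exists_conj hτ hπ hpM hf
    have hdp : π d (FreeGroup.of p) = FreeGroup.of p :=
      fixes_of_mem_closure hπ (Or.inl (Nat.lt_succ_self p)) hd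
    have hk1 : w * FreeGroup.of p * w⁻¹ = FreeGroup.of k := by
      have := DFunLike.congr_fun hx1 (FreeGroup.of k)
      simpa [map_prodFrom_of hπ hk hkM, hdp, hw] using this
    obtain rfl : k = p := by
      by_contra hne
      have := congrArg
        (FreeGroup.lift fun j => if j = p then Multiplicative.ofAdd (1 : ℤ) else 1) hk1
      simp [hne] at this
    rw [prodFrom_self, mul_one] at hx1 ⊢
    have hcomm : Commute w (FreeGroup.of k) := by
      rw [commute_iff_eq]
      exact mul_inv_eq_iff_eq_mul.1 hk1
    have hw1 : killGen k w = 1 :=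
      FreeGroup.map_eq_one_of_commute hcomm (FreeGroup.of_ne_one k) _ (killGen_of_self k)
    obtain rfl : f = 1 := by simpa [hw1] using hkw.symm
    rw [map_one, one_mul] at hx1 ⊢
    exact ih hd hx1

end Faithful

section FixedPoints

/-- The cyclic permutation of the first `n + 1` generators of the free group. -/
def cycleGen (n : ℕ) : Monoid.End (FreeGroup ℕ) :=
  FreeGroup.lift fun j => FreeGroup.of ((j + 1) % (n + 1))

theorem cycleGen_of (n j : ℕ) :
    cycleGen n (FreeGroup.of j) = FreeGroup.of ((j + 1) % (n + 1)) :=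
  FreeGroup.lift_apply_of

theorem cycleGen_pow_of {n j : ℕ} (hj : j ≤ n) (k : ℕ) :
    (cycleGen n ^ k) (FreeGroup.of j) = FreeGroup.of ((j + k) % (n + 1)) := by
  induction k with
  | zero => simp [Nat.mod_eq_of_lt (Nat.lt_succ_of_le hj)]
  | succ k ih =>
    rw [pow_succ', Monoid.End.coe_mul, Function.comp_apply, ih, cycleGen_of, Nat.mod_add_mod,
      add_assoc]

/-- The exponent sum of a word in a free group. -/
def exponentSum : FreeGroup ℕ →* Multiplicative ℤ :=
  FreeGroup.lift fun _ => Multiplicative.ofAdd 1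

theorem exponentSum_of (j : ℕ) : exponentSum (FreeGroup.of j) = Multiplicative.ofAdd 1 :=
  FreeGroup.lift_apply_of

theorem prodFrom_artinAut_of_lt {i k : ℕ} (hik : i < k) :
    prodFrom artinAut 0 k (FreeGroup.of i) =
      (FreeGroup.of 0)⁻¹ * FreeGroup.of (i + 1) * FreeGroup.of 0 := by
  induction k, Nat.succ_le_of_lt hik using Nat.le_induction with
  | base =>
    have h1 : prodFrom artinAut 0 i (FreeGroup.of (i + 1)) = FreeGroup.of (i + 1) :=
      fixes_of_mem_closure (π := MonoidHom.id _) (M := i) (fun _ _ => rfl)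
        (Or.inr (Nat.lt_succ_self i)) (prodFrom_mem (Nat.zero_le i) le_rfl)
    have h2 : prodFrom artinAut 0 i (FreeGroup.of i) = FreeGroup.of 0 :=
      map_prodFrom_of (π := MonoidHom.id _) (M := i) (fun _ _ => rfl) (Nat.zero_le i) le_rfl
    rw [Nat.succ_eq_add_one, prodFrom_succ _ (Nat.zero_le i), MulAut.mul_apply, artinAut_of_self]
    simp [h1, h2]
  | succ k hk ih =>
    rw [prodFrom_succ _ (Nat.zero_le k), MulAut.mul_apply, artinAut_of_of_ne (by omega) (by omega),
      ih (by omega)]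

theorem conj_prodFrom_artinAut {n : ℕ} {f : FreeGroup ℕ}
    (hf : f ∈ Subgroup.closure (FreeGroup.of '' Set.Icc 0 n)) :
    FreeGroup.of 0 * prodFrom artinAut 0 n f * (FreeGroup.of 0)⁻¹ = cycleGen n f := by
  have : Set.EqOn ((MulAut.conj (FreeGroup.of 0) * prodFrom artinAut 0 n).toMonoidHom)
      (cycleGen n) (Subgroup.closure (FreeGroup.of '' Set.Icc 0 n)) := by
    refine MonoidHom.eqOn_closure (g := (cycleGen n : FreeGroup ℕ →* FreeGroup ℕ)) ?_
    rintro _ ⟨j, ⟨-, hj⟩, rfl⟩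
    have hc := cycleGen_of n j
    rcases Nat.lt_or_eq_of_le hj with hlt | rfl
    · rw [Nat.mod_eq_of_lt (by omega)] at hc
      refine Eq.trans ?_ hc.symm
      simp [prodFrom_artinAut_of_lt hlt, mul_assoc]
    · rw [Nat.mod_self] at hc
      refine Eq.trans ?_ hc.symm
      have h2 : prodFrom artinAut 0 j (FreeGroup.of j) = FreeGroup.of 0 :=
        map_prodFrom_of (π := MonoidHom.id _) (M := j) (fun _ _ => rfl) (Nat.zero_le j) le_rfl
      simp [h2]
  exact this hf

/-- A word of exponent sum zero that is fixed by the braid group is trivial. -/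
theorem eq_one_of_artinAut_fixed {n : ℕ} {f : FreeGroup ℕ}
    (hf : f ∈ Subgroup.closure (FreeGroup.of '' Set.Icc 0 n))
    (hfix : ∀ i < n, artinAut i f = f) (hdeg : exponentSum f = 1) : f = 1 := by
  have hC : prodFrom artinAut 0 n f = f := by
    have : Subgroup.closure (artinAut '' Set.Ico 0 n) ≤
        MulAction.stabilizer (MulAut (FreeGroup ℕ)) f := by
      rw [Subgroup.closure_le]
      rintro _ ⟨i, ⟨-, hi⟩, rfl⟩
      exact hfix i hi
    exact this (prodFrom_mem (Nat.zero_le n) le_rfl)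
  have hr : cycleGen n f = FreeGroup.of 0 * f * (FreeGroup.of 0)⁻¹ := by
    rw [← conj_prodFrom_artinAut hf, hC]
  have hdeg' : ∀ y, exponentSum (cycleGen n y) = exponentSum y := by
    have : exponentSum.comp (cycleGen n : FreeGroup ℕ →* FreeGroup ℕ) = exponentSum := by
      refine FreeGroup.ext_hom _ _ fun j => ?_
      have := congrArg exponentSum (cycleGen_of n j)
      rw [exponentSum_of] at this ⊢
      exact this
    exact DFunLike.congr_fun this
  have hpow : ∀ k : ℕ, ∃ P : FreeGroup ℕ, exponentSum P = Multiplicative.ofAdd (k : ℤ) ∧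
      (cycleGen n ^ k) f = P * f * P⁻¹ := by
    intro k
    induction k with
    | zero => exact ⟨1, by simp, by simp⟩
    | succ k ih =>
      obtain ⟨P, hP, hPf⟩ := ih
      refine ⟨cycleGen n P * FreeGroup.of 0, ?_, ?_⟩
      · rw [map_mul, hdeg', hP, exponentSum_of, ← ofAdd_add]
        push_cast
        rfl
      · rw [pow_succ', Monoid.End.coe_mul, Function.comp_apply, hPf, map_mul, map_mul, map_inv, hr]
        group
  have hperiod : (cycleGen n ^ (n + 1)) f = f := by
    have : Set.EqOn (cycleGen n ^ (n + 1)) (MonoidHom.id _)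
        (Subgroup.closure (FreeGroup.of '' Set.Icc 0 n)) := by
      refine MonoidHom.eqOn_closure
        (f := ((cycleGen n ^ (n + 1) : Monoid.End _) : FreeGroup ℕ →* FreeGroup ℕ)) ?_
      rintro _ ⟨j, ⟨-, hj⟩, rfl⟩
      refine (cycleGen_pow_of hj _).trans ?_
      rw [Nat.add_mod_right, Nat.mod_eq_of_lt (by omega)]
      rfl
    exact this hf
  obtain ⟨P, hP, hPf⟩ := hpow (n + 1)
  rw [hperiod] at hPf
  have hcomm : Commute P f := mul_inv_eq_iff_eq_mul.1 hPf.symm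
  by_contra hne
  have h1 := FreeGroup.map_eq_one_of_commute hcomm hne exponentSum hdeg
  rw [hP, ofAdd_eq_one] at h1
  omega

end FixedPoints

section AffineTypeB

variable {E : Type*} [Group E] {e : ℕ → E} {n : ℕ}

theorem prodFrom_zero_eq {j : ℕ} (hj : 1 ≤ j) : prodFrom e 0 j = e 0 * prodFrom e 1 j := by
  induction j, hj using Nat.le_induction with
  | base => rw [prodFrom_succ e le_rfl]; simp
  | succ j hj ih => rw [prodFrom_succ e (Nat.zero_le j), ih, prodFrom_succ e hj, mul_assoc]

theorem BraidRel.prodFrom_semiconj (h : BraidRel e n) {j : ℕ} (hj : j + 1 ≤ n) :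
    SemiconjBy (prodFrom e 0 n) (prodFrom e 0 j) (prodFrom e 1 (j + 1)) := by
  induction j with
  | zero => simp
  | succ j ih =>
    rw [prodFrom_succ e (Nat.zero_le j), prodFrom_succ e (by omega : 1 ≤ j + 1)]
    exact (ih (by omega)).mul_right (h.semiconj_prodFrom (Nat.zero_le j) hj le_rfl)

/-- The relation `τ e₀ τ e₀ = e₀ τ e₀ τ` in terms of the rotation `τ e₀ ⋯ e_{n-1}`. -/
theorem BraidRel.semiconj_rotation_iff (h : BraidRel e n) (hn : 1 ≤ n) {t : E}
    (ht : ∀ i, 0 < i → i < n → Commute (e i) t) :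
    SemiconjBy (t * prodFrom e 0 n * (t * prodFrom e 0 n)) (e (n - 1)) (e 0) ↔
      Commute t (e 0 * t * e 0) := by
  obtain ⟨m, rfl⟩ : ∃ m, n = m + 1 := ⟨n - 1, by omega⟩
  rw [Nat.add_sub_cancel]
  set c := prodFrom e 0 (m + 1) with hc
  set c' := prodFrom e 1 (m + 1) with hc'
  have hcc : c = e 0 * c' := prodFrom_zero_eq hn
  have hcm : c' * c * e m = c * c := by
    rw [← (h.prodFrom_semiconj le_rfl).eq, mul_assoc, ← prodFrom_succ e (Nat.zero_le m)]
  have hct : c' * t = t * c' := by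
    have : Subgroup.closure (e '' Set.Ico 1 (m + 1)) ≤ Subgroup.centralizer {t} := by
      rw [Subgroup.closure_le]
      rintro _ ⟨i, ⟨hi, him⟩, rfl⟩
      exact Subgroup.mem_centralizer_singleton_iff.2 (ht i hi him).eq
    exact Subgroup.mem_centralizer_singleton_iff.1 (this (prodFrom_mem hn le_rfl))
  have hsq : t * c * (t * c) = t * e 0 * t * (c' * c) := by
    calc t * c * (t * c) = t * e 0 * (c' * t) * c := by rw [hcc]; group
      _ = _ := by rw [hct]; group
  have hl : t * c * (t * c) * e m = t * (e 0 * t * e 0) * (c' * c) := by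
    calc t * c * (t * c) * e m = t * e 0 * t * (c' * c * e m) := by rw [hsq]; group
      _ = t * e 0 * t * (e 0 * c' * c) := by rw [hcm, ← hcc]
      _ = _ := by group
  have hr : e 0 * (t * c * (t * c)) = e 0 * t * e 0 * t * (c' * c) := by rw [hsq]; group
  rw [SemiconjBy, hl, hr, mul_left_inj]
  rfl

end AffineTypeB

section AffineHom

variable {n : ℕ}

theorem ZMod.val_add_one_mod (i : ZMod (n + 1)) : (i + 1).val = (i.val + 1) % (n + 1) := by
  rw [ZMod.val_add, ZMod.val_one_eq_one_mod, Nat.add_mod_mod]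

/-- Elements `e 0, …, e (n - 1)` satisfying the braid relations and an element `ρ` that shifts
them cyclically (through `ρ * e (n - 1) * ρ⁻¹`). -/
structure AffineData {E : Type*} [Group E] (e : ℕ → E) (ρ : E) (n : ℕ) : Prop
    extends BraidRel e n where
  shift : ∀ i, i + 1 < n → SemiconjBy ρ (e i) (e (i + 1))
  shift_last : SemiconjBy (ρ * ρ) (e (n - 1)) (e 0)

namespace AffineData

variable {E : Type*} [Group E] {e : ℕ → E} {ρ : E}

theorem pow_semiconj (h : AffineData e ρ n) {k : ℕ} (hk : k < n) :
    SemiconjBy (ρ ^ k) (e 0) (e k) := by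
  induction k with
  | zero => simp
  | succ k ih =>
    rw [pow_succ']
    exact (h.shift k hk).mul_left (ih (by omega))

theorem conj_pow_eq (h : AffineData e ρ n) {k : ℕ} (hk : k < n) :
    MulAut.conj (ρ ^ k) (e 0) = e k := by
  rw [MulAut.conj_apply, (h.pow_semiconj hk).eq, mul_inv_cancel_right]

theorem conj_pow_mod (h : AffineData e ρ n) (hn : 1 ≤ n) (k : ℕ) :
    MulAut.conj (ρ ^ (k % (n + 1))) (e 0) = MulAut.conj (ρ ^ k) (e 0) := by
  have hper : MulAut.conj (ρ ^ (n + 1)) (e 0) = e 0 := by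
    have h1 : n + 1 = 2 + (n - 1) := by omega
    have h2 := h.shift_last.mul_left (h.pow_semiconj (k := n - 1) (by omega))
    rw [← pow_two, ← pow_add, ← h1] at h2
    rw [MulAut.conj_apply, h2.eq, mul_inv_cancel_right]
  have hper' : ∀ q : ℕ, MulAut.conj ((ρ ^ (n + 1)) ^ q) (e 0) = e 0 := by
    intro q
    induction q with
    | zero => simp
    | succ q ih => rw [pow_succ, map_mul, MulAut.mul_apply, hper, ih]
  conv_rhs => rw [← Nat.mod_add_div k (n + 1), pow_add, pow_mul, map_mul, MulAut.mul_apply, hper']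

theorem relations (h : AffineData e ρ n) (hn : 2 ≤ n) :
    ∀ r ∈ relsArtinAtilde n,
      FreeGroup.lift (fun i : ZMod (n + 1) => MulAut.conj (ρ ^ i.val) (e 0)) r = 1 := by
  have hcomm : ∀ i j : ℕ, i < j → j ≤ n → j ≠ i + 1 → (i = 0 → j ≠ n) →
      Commute (MulAut.conj (ρ ^ i) (e 0)) (MulAut.conj (ρ ^ j) (e 0)) := by
    intro i j hij hj h1 h2
    obtain ⟨d, rfl⟩ := Nat.exists_eq_add_of_lt hij
    rw [add_assoc, pow_add, map_mul, MulAut.mul_apply, h.conj_pow_eq (k := d + 1) (by omega)]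
    exact (h.comm 0 (d + 1) (by omega) (by omega)).map (MulAut.conj (ρ ^ i))
  rintro r (⟨i, rfl⟩ | ⟨i, j, h1, h2, rfl⟩)
  · simp only [map_mul, map_inv, FreeGroup.lift_apply_of]
    rw [ZMod.val_add_one_mod, h.conj_pow_mod (by omega), mul_inv_eq_one, pow_succ, map_mul,
      MulAut.mul_apply]
    have h3 := h.conj_pow_eq (k := 1) (by omega)
    rw [pow_one] at h3
    rw [h3, ← map_mul, ← map_mul, h.braid 0 (by omega), map_mul, map_mul]
  · simp only [map_mul, map_inv, FreeGroup.lift_apply_of]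
    rw [mul_inv_eq_one]
    have hi := ZMod.val_lt i
    have hj := ZMod.val_lt j
    have g1 : j.val ≠ (i.val + 1) % (n + 1) := by
      rw [← ZMod.val_add_one_mod]
      exact fun h => h1 (ZMod.val_injective _ h)
    have g2 : i.val ≠ (j.val + 1) % (n + 1) := by
      rw [← ZMod.val_add_one_mod]
      exact fun h => h2 (by rw [ZMod.val_injective _ h]; ring)
    rcases lt_trichotomy i.val j.val with hlt | heq | hgt
    · refine (hcomm _ _ hlt (by omega) ?_ ?_).eq
      · rwa [Nat.mod_eq_of_lt (by omega)] at g1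
      · intro h0 h'
        rw [h', Nat.mod_self] at g2
        exact g2 h0
    · rw [heq]
    · refine (hcomm _ _ hgt (by omega) ?_ ?_).eq.symm
      · rwa [Nat.mod_eq_of_lt (by omega)] at g2
      · intro h0 h'
        rw [h', Nat.mod_self] at g1
        exact g1 h0

/-- The homomorphism out of the affine Artin group determined by affine data. -/
def hom (h : AffineData e ρ n) (hn : 2 ≤ n) : PresentedGroup (relsArtinAtilde n) →* E :=
  PresentedGroup.toGroup (h.relations hn)

theorem hom_of (h : AffineData e ρ n) (hn : 2 ≤ n) (i : ZMod (n + 1)) :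
    h.hom hn (PresentedGroup.of i) = MulAut.conj (ρ ^ i.val) (e 0) :=
  PresentedGroup.toGroup.of _

end AffineData

theorem TypeB.affineData {E : Type*} [Group E] {e τ : ℕ → E} (h : TypeB e τ n 0) (hn : 1 ≤ n) :
    AffineData e (τ 0 * prodFrom e 0 n) n where
  toBraidRel := h.toBraidRel
  shift i hi := SemiconjBy.mul_left (h.comm_base (i + 1) (by omega) hi).symm
    (h.semiconj_prodFrom (Nat.zero_le i) hi le_rfl)
  shift_last := (h.semiconj_rotation_iff hn h.comm_base).2 (h.rel_base hn)

theorem AffineData.typeB {E : Type*} [Group E] {e : ℕ → E} {ρ : E} (h : AffineData e ρ n)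
    (hn : 1 ≤ n) : TypeB e
      (fun j => (prodFrom e 0 j)⁻¹ * (ρ * (prodFrom e 0 n)⁻¹) * prodFrom e 0 j) n 0 := by
  have hc : ∀ i, 0 < i → i < n → Commute (e i) (ρ * (prodFrom e 0 n)⁻¹) := by
    intro i hi hin
    obtain ⟨i, rfl⟩ : ∃ k, i = k + 1 := ⟨i - 1, by omega⟩
    exact ((h.shift i hin).mul_left
      (h.semiconj_prodFrom (Nat.zero_le i) hin le_rfl).inv_symm_left).symm
  refine h.typeB_conj hc fun _ => ?_
  rw [← h.semiconj_rotation_iff hn hc, inv_mul_cancel_right]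
  exact h.shift_last

/-- The cyclic shift of the generators, as an endomorphism. -/
def shiftHom (n : ℕ) (a : ZMod (n + 1)) :
    PresentedGroup (relsArtinAtilde n) →* PresentedGroup (relsArtinAtilde n) :=
  PresentedGroup.toGroup (f := fun i => PresentedGroup.of (i + a)) (by
    rintro r (⟨i, rfl⟩ | ⟨i, j, h1, h2, rfl⟩)
    · simp only [map_mul, map_inv, FreeGroup.lift_apply_of]
      have : PresentedGroup.mk (relsArtinAtilde n) _ = 1 :=
        PresentedGroup.one_of_mem (Or.inl ⟨i + a, rfl⟩)
      rw [add_right_comm]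
      exact this
    · simp only [map_mul, map_inv, FreeGroup.lift_apply_of]
      have : PresentedGroup.mk (relsArtinAtilde n) _ = 1 :=
        PresentedGroup.one_of_mem (Or.inr ⟨i + a, j + a,
          fun h => h1 (add_right_cancel (h.trans (add_right_comm _ _ _))),
          fun h => h2 (add_right_cancel (h.trans (by ring))), rfl⟩)
      exact this)

theorem shiftHom_of (a i : ZMod (n + 1)) :
    shiftHom n a (PresentedGroup.of i) = PresentedGroup.of (i + a) :=
  PresentedGroup.toGroup.of _

/-- The cyclic shift of the generators, as an automorphism. -/
def shiftAut (n : ℕ) : MulAut (PresentedGroup (relsArtinAtilde n)) :=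
  MonoidHom.toMulEquiv (shiftHom n 1) (shiftHom n (-1))
    (by ext i; simp [shiftHom_of]) (by ext i; simp [shiftHom_of])

theorem shiftAut_of (i : ZMod (n + 1)) :
    shiftAut n (PresentedGroup.of i) = PresentedGroup.of (i + 1) :=
  shiftHom_of 1 i

/-- The extension of the affine Artin group by the cyclic shift. -/
abbrev ExtendedArtin (n : ℕ) : Type :=
  PresentedGroup (relsArtinAtilde n) ⋊[zpowersHom _ (shiftAut n)] Multiplicative ℤ

namespace ExtendedArtin

/-- The generators of the affine Artin group in the extension, indexed by natural numbers. -/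
def gen (n i : ℕ) : ExtendedArtin n :=
  SemidirectProduct.inl (PresentedGroup.of (i : ZMod (n + 1)))

/-- The rotation in the extension. -/
def rot (n : ℕ) : ExtendedArtin n := SemidirectProduct.inr (Multiplicative.ofAdd 1)

theorem rot_conj_inl (g : PresentedGroup (relsArtinAtilde n)) :
    SemiconjBy (rot n) (SemidirectProduct.inl g) (SemidirectProduct.inl (shiftAut n g)) := by
  have := SemidirectProduct.inl_aut (φ := zpowersHom _ (shiftAut n)) (Multiplicative.ofAdd 1) g
  simp only [zpowersHom_apply, toAdd_ofAdd, zpow_one] at this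
  rw [this, SemiconjBy, rot]
  simp

theorem rot_conj_gen (i : ℕ) : SemiconjBy (rot n) (gen n i) (gen n (i + 1)) := by
  have := rot_conj_inl (PresentedGroup.of (rels := relsArtinAtilde n) (i : ZMod (n + 1)))
  rw [shiftAut_of] at this
  simpa [gen] using this

theorem affineData (hn : 1 ≤ n) : AffineData (gen n) (rot n) n where
  braid i hi := by
    simp only [gen, ← map_mul]
    congr 1
    rw [← mul_inv_eq_one]
    push_cast
    exact PresentedGroup.one_of_mem (Or.inl ⟨(i : ZMod (n + 1)), rfl⟩)
  comm i j hij hj := by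
    have : Commute (PresentedGroup.of (rels := relsArtinAtilde n) (i : ZMod (n + 1)))
        (PresentedGroup.of (j : ZMod (n + 1))) := by
      rw [commute_iff_eq, ← mul_inv_eq_one]
      refine PresentedGroup.one_of_mem (Or.inr ⟨_, _, fun h => ?_, fun h => ?_, rfl⟩)
      · have := congrArg ZMod.val h
        rw [← Nat.cast_add_one, ZMod.val_natCast_of_lt (by omega),
          ZMod.val_natCast_of_lt (by omega)] at this
        omega
      · have := congrArg ZMod.val (eq_sub_iff_add_eq.1 h)
        rw [← Nat.cast_add_one, ZMod.val_natCast_of_lt (by omega),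
          ZMod.val_natCast_of_lt (by omega)] at this
        omega
    exact this.map SemidirectProduct.inl
  shift i _ := rot_conj_gen i
  shift_last := by
    obtain ⟨m, rfl⟩ : ∃ m, n = m + 1 := ⟨n - 1, by omega⟩
    have h1 := (rot_conj_gen (n := m + 1) (m + 1)).mul_left (rot_conj_gen m)
    have h2 : gen (m + 1) (m + 1 + 1) = gen (m + 1) 0 := by
      simp only [gen]
      rw [ZMod.natCast_self, Nat.cast_zero]
    rwa [h2] at h1

theorem closure_gen_rot : ∀ H : Subgroup (ExtendedArtin n), gen n 0 ∈ H → rot n ∈ H → H = ⊤ := by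
  intro H h0 hr
  have hg : ∀ i, gen n i ∈ H := by
    intro i
    induction i with
    | zero => exact h0
    | succ i ih =>
      have := H.mul_mem (H.mul_mem hr ih) (H.inv_mem hr)
      rwa [(rot_conj_gen i).eq, mul_inv_cancel_right] at this
  rw [Subgroup.eq_top_iff']
  intro x
  rw [← SemidirectProduct.inl_left_mul_inr_right x]
  refine H.mul_mem ?_ ?_
  · have : Subgroup.closure (Set.range (PresentedGroup.of (rels := relsArtinAtilde n))) ≤
        H.comap SemidirectProduct.inl := by
      rw [Subgroup.closure_le]
      rintro _ ⟨i, rfl⟩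
      have := hg i.val
      rwa [gen, ZMod.natCast_zmod_val] at this
    rw [PresentedGroup.closure_range_of] at this
    exact this (Subgroup.mem_top _)
  · have : (SemidirectProduct.inr x.right : ExtendedArtin n) = rot n ^ (x.right.toAdd) := by
      rw [rot, ← map_zpow, ← ofAdd_zsmul]
      simp
    rw [this]
    exact H.zpow_mem hr _

variable {E : Type*} [Group E] {e : ℕ → E} {ρ : E}

theorem hom_shiftAut (h : AffineData e ρ n) (hn : 2 ≤ n) (x : PresentedGroup (relsArtinAtilde n)) :
    h.hom hn (shiftAut n x) = MulAut.conj ρ (h.hom hn x) := by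
  have : (h.hom hn).comp (shiftAut n).toMonoidHom =
      (MulAut.conj ρ).toMonoidHom.comp (h.hom hn) := by
    ext i
    simp only [MonoidHom.comp_apply, MulEquiv.coe_toMonoidHom, shiftAut_of, h.hom_of]
    rw [ZMod.val_add_one_mod, h.conj_pow_mod (by omega), pow_succ', map_mul, MulAut.mul_apply]
  exact DFunLike.congr_fun this x

theorem hom_shiftAut_zpow (h : AffineData e ρ n) (hn : 2 ≤ n) (k : ℤ)
    (x : PresentedGroup (relsArtinAtilde n)) :
    h.hom hn ((shiftAut n ^ k) x) = MulAut.conj (ρ ^ k) (h.hom hn x) := by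
  induction k generalizing x with
  | zero => simp
  | succ k ih => rw [zpow_add_one, zpow_add_one, MulAut.mul_apply, ih, hom_shiftAut, map_mul,
      MulAut.mul_apply]
  | pred k ih =>
    rw [zpow_sub_one, zpow_sub_one, MulAut.mul_apply, ih, map_mul, MulAut.mul_apply]
    congr 1
    apply (MulAut.conj ρ).injective
    rw [← hom_shiftAut]
    simp [mul_assoc]

/-- The homomorphism out of the extended affine Artin group determined by affine data. -/
def hom (h : AffineData e ρ n) (hn : 2 ≤ n) : ExtendedArtin n →* E :=
  SemidirectProduct.lift (h.hom hn) (zpowersHom E ρ) (by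
    intro g
    ext1 i
    simp [zpowersHom_apply, hom_shiftAut_zpow])

theorem hom_rot (h : AffineData e ρ n) (hn : 2 ≤ n) : hom h hn (rot n) = ρ := by
  simp [hom, rot, zpowersHom_apply]

theorem hom_gen (h : AffineData e ρ n) (hn : 2 ≤ n) {i : ℕ} (hi : i < n) :
    hom h hn (gen n i) = e i := by
  rw [hom, gen, SemidirectProduct.lift_inl, h.hom_of, ZMod.val_natCast_of_lt (by omega),
    h.conj_pow_eq hi]

end ExtendedArtin

end AffineHom

section Naturality

variable {E E' : Type*} [Group E] [Group E'] {e τ : ℕ → E} {e' τ' : ℕ → E'} {M p : ℕ}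

theorem BraidRel.map (h : BraidRel e M) (φ : E →* E') : BraidRel (fun i => φ (e i)) M where
  braid i hi := by simp only [← map_mul, h.braid i hi]
  comm i j hij hj := (h.comm i j hij hj).map φ

theorem map_prodFrom (φ : E →* E') (he : ∀ i < M, φ (e i) = e' i) {k : ℕ} (hk : p ≤ k)
    (hkM : k ≤ M) : φ (prodFrom e p k) = prodFrom e' p k := by
  induction k, hk using Nat.le_induction with
  | base => simp
  | succ k hk ih =>
    rw [prodFrom_succ e hk, prodFrom_succ e' hk, map_mul, ih (by omega), he k (by omega)]

theorem TypeB.map_eq (h : TypeB e τ M p) (h' : TypeB e' τ' M p) (φ : E →* E')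
    (he : ∀ i < M, φ (e i) = e' i) (hτ : φ (τ p) = τ' p) {j : ℕ} (hj : p ≤ j) (hjM : j ≤ M) :
    φ (τ j) = τ' j := by
  induction j, hj using Nat.le_induction with
  | base => exact hτ
  | succ j hj ih =>
    have h1 := (h.step j hj hjM).map φ
    have h2 := h'.step j hj hjM
    rw [he j hjM, ih (by omega)] at h1
    exact mul_left_cancel (h1.eq.trans h2.eq.symm)

theorem exponentSum_of_map_eq (φ : E →* Multiplicative ℤ)
    (hτ : ∀ j, p ≤ j → j ≤ M → φ (τ j) = Multiplicative.ofAdd 1) {f : FreeGroup ℕ}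
    (hf : f ∈ Subgroup.closure (FreeGroup.of '' Set.Icc p M)) :
    φ (FreeGroup.lift τ f) = exponentSum f := by
  refine MonoidHom.eqOn_closure (f := φ.comp (FreeGroup.lift τ)) (g := exponentSum) ?_ hf
  rintro _ ⟨j, ⟨hj, hjM⟩, rfl⟩
  rw [MonoidHom.comp_apply, FreeGroup.lift_apply_of, hτ j hj hjM, exponentSum_of]

end Naturality

/-- The holomorph of the free group on countably many generators. -/
abbrev FreeHolomorph : Type := FreeGroup ℕ ⋊[MonoidHom.id _] MulAut (FreeGroup ℕ)

namespace FreeHolomorph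

open SemidirectProduct

theorem commute_inr_iff {f : FreeGroup ℕ} {β σ : MulAut (FreeGroup ℕ)} :
    Commute (inl f * inr β : FreeHolomorph) (inr σ) ↔ σ f = f ∧ Commute β σ := by
  rw [commute_iff_eq, commute_iff_eq, SemidirectProduct.ext_iff]
  simp [eq_comm]

theorem typeB (n : ℕ) : TypeB (fun i => (inr (artinAut i) : FreeHolomorph))
    (fun j => inl (FreeGroup.of j)) n 0 where
  toBraidRel := (artinAut_braidRel n).map inr
  step j _ _ := by
    rw [SemiconjBy, SemidirectProduct.ext_iff]
    simp
  comm_base i hi _ := by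
    rw [commute_iff_eq, SemidirectProduct.ext_iff]
    simp [artinAut_of_of_ne (i := i) (j := 0) (by omega) (by omega)]
  rel_base _ := by
    rw [commute_iff_eq, SemidirectProduct.ext_iff]
    simp [mul_assoc]

end FreeHolomorph

namespace ExtendedArtin

open SemidirectProduct

variable {n : ℕ}

/-- The action of the extended affine Artin group on the free group, by affine maps. -/
def toHolomorph (hn : 2 ≤ n) : ExtendedArtin n →* FreeHolomorph :=
  hom ((FreeHolomorph.typeB n).affineData (by omega)) hn

theorem toHolomorph_gen (hn : 2 ≤ n) {i : ℕ} (hi : i < n) :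
    toHolomorph hn (gen n i) = inr (artinAut i) :=
  hom_gen _ hn hi

/-- The translations in the extended affine Artin group. -/
def translation (n j : ℕ) : ExtendedArtin n :=
  (prodFrom (gen n) 0 j)⁻¹ * (rot n * (prodFrom (gen n) 0 n)⁻¹) * prodFrom (gen n) 0 j

theorem typeB (hn : 1 ≤ n) : TypeB (gen n) (translation n) n 0 :=
  (affineData hn).typeB hn

theorem rot_eq (n : ℕ) : rot n = translation n 0 * prodFrom (gen n) 0 n := by
  simp [translation]

theorem toHolomorph_translation (hn : 2 ≤ n) {j : ℕ} (hj : j ≤ n) :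
    toHolomorph hn (translation n j) = inl (FreeGroup.of j) := by
  refine (typeB (by omega)).map_eq (FreeHolomorph.typeB n) (toHolomorph hn)
    (fun i hi => toHolomorph_gen hn hi) ?_ (Nat.zero_le j) hj
  have h1 : toHolomorph hn (rot n) = _ := hom_rot _ hn
  rw [rot_eq, map_mul, map_prodFrom (toHolomorph hn) (fun i hi => toHolomorph_gen hn hi)
    (Nat.zero_le n) le_rfl] at h1
  exact mul_right_cancel h1

theorem toHolomorph_lift (hn : 2 ≤ n) {f : FreeGroup ℕ}
    (hf : f ∈ Subgroup.closure (FreeGroup.of '' Set.Icc 0 n)) :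
    toHolomorph hn (FreeGroup.lift (translation n) f) = inl f := by
  refine MonoidHom.eqOn_closure (f := (toHolomorph hn).comp (FreeGroup.lift (translation n)))
    (g := inl) ?_ hf
  rintro _ ⟨j, ⟨_, hj⟩, rfl⟩
  rw [MonoidHom.comp_apply, FreeGroup.lift_apply_of, toHolomorph_translation hn hj]

theorem toHolomorph_of_mem (hn : 2 ≤ n) {d : ExtendedArtin n}
    (hd : d ∈ Subgroup.closure (gen n '' Set.Ico 0 n)) :
    toHolomorph hn d = inr (toHolomorph hn d).right := by
  refine MonoidHom.eqOn_closure (f := toHolomorph hn)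
    (g := inr.comp (rightHom.comp (toHolomorph hn))) ?_ hd
  rintro _ ⟨i, ⟨_, hi⟩, rfl⟩
  simp [toHolomorph_gen hn hi]

theorem rightHom_gen (i : ℕ) : rightHom (gen n i) = 1 :=
  rightHom_inl _

theorem rightHom_of_mem {d : ExtendedArtin n}
    (hd : d ∈ Subgroup.closure (gen n '' Set.Ico 0 n)) : rightHom d = 1 := by
  refine MonoidHom.eqOn_closure (f := rightHom) (g := 1) ?_ hd
  rintro _ ⟨i, -, rfl⟩
  exact rightHom_gen i

theorem rightHom_translation {j : ℕ} (hj : j ≤ n) :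
    rightHom (translation n j) = Multiplicative.ofAdd 1 := by
  have h1 := rightHom_of_mem (n := n) (prodFrom_mem (Nat.zero_le j) hj)
  have h2 := rightHom_of_mem (n := n) (prodFrom_mem (Nat.zero_le n) le_rfl)
  rw [translation, map_mul, map_mul, map_mul, map_inv, map_inv, h1, h2]
  simp [rot]

theorem exists_lift_mul (hn : 1 ≤ n) (x : ExtendedArtin n) :
    ∃ f ∈ Subgroup.closure (FreeGroup.of '' Set.Icc 0 n),
      ∃ d ∈ Subgroup.closure (gen n '' Set.Ico 0 n),
        x = FreeGroup.lift (translation n) f * d := by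
  refine (typeB hn).exists_mul_of_mem_sup ?_
  rw [closure_gen_rot (Subgroup.closure (translation n '' Set.Icc 0 n) ⊔
    Subgroup.closure (gen n '' Set.Ico 0 n))]
  · exact Subgroup.mem_top x
  · exact Subgroup.mem_sup_right (Subgroup.subset_closure ⟨0, ⟨le_rfl, by omega⟩, rfl⟩)
  · rw [rot_eq]
    exact Subgroup.mul_mem_sup (Subgroup.subset_closure ⟨0, ⟨le_rfl, by omega⟩, rfl⟩)
      (prodFrom_mem (Nat.zero_le n) le_rfl)

theorem commute_artinAut_of_mem_center (hn : 2 ≤ n) {z : PresentedGroup (relsArtinAtilde n)}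
    (hz : z ∈ Subgroup.center (PresentedGroup (relsArtinAtilde n))) {i : ℕ} (hi : i < n) :
    Commute (toHolomorph hn (inl z)) (inr (artinAut i)) := by
  rw [← toHolomorph_gen hn hi]
  exact (Commute.map (Subgroup.mem_center_iff.1 hz _).symm inl).map (toHolomorph hn)

theorem inl_mem_of_mem_center (hn : 2 ≤ n) {z : PresentedGroup (relsArtinAtilde n)}
    (hz : z ∈ Subgroup.center (PresentedGroup (relsArtinAtilde n))) :
    inl z ∈ Subgroup.closure (gen n '' Set.Ico 0 n) := by
  obtain ⟨f, hf, d, hd, hx⟩ := exists_lift_mul (by omega) (inl z : ExtendedArtin n)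
  suffices f = 1 by simpa [hx, this] using hd
  refine eq_one_of_artinAut_fixed hf (fun i hi => ?_) ?_
  · have := commute_artinAut_of_mem_center hn hz hi
    rw [hx, map_mul, toHolomorph_lift hn hf, toHolomorph_of_mem hn hd] at this
    exact (FreeHolomorph.commute_inr_iff.1 this).1
  · rw [← exponentSum_of_map_eq rightHom (fun j _ hj => rightHom_translation hj) hf]
    have := congrArg rightHom hx
    rwa [rightHom_inl, map_mul, rightHom_of_mem hd, mul_one, eq_comm] at this

theorem right_toHolomorph_of_zero (hn : 2 ≤ n) {z : PresentedGroup (relsArtinAtilde n)}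
    (hz : z ∈ Subgroup.center (PresentedGroup (relsArtinAtilde n))) :
    (toHolomorph hn (inl z)).right (FreeGroup.of 0) = FreeGroup.of 0 := by
  have hz' : (shiftAut n).symm z ∈ Subgroup.center (PresentedGroup (relsArtinAtilde n)) := by
    rw [Subgroup.mem_center_iff] at hz ⊢
    intro g
    apply (shiftAut n).injective
    rw [map_mul, map_mul, MulEquiv.apply_symm_apply, hz]
  have h := (rot_conj_inl ((shiftAut n).symm z)).map (toHolomorph hn)
  rw [MulEquiv.apply_symm_apply, toHolomorph_of_mem hn (inl_mem_of_mem_center hn hz),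
    toHolomorph_of_mem hn (inl_mem_of_mem_center hn hz'), rot_eq, map_mul,
    toHolomorph_translation hn (Nat.zero_le n),
    toHolomorph_of_mem hn (prodFrom_mem (Nat.zero_le n) le_rfl)] at h
  simpa using (congrArg SemidirectProduct.left h.eq).symm

theorem right_toHolomorph_of_mem_center (hn : 2 ≤ n) {z : PresentedGroup (relsArtinAtilde n)}
    (hz : z ∈ Subgroup.center (PresentedGroup (relsArtinAtilde n))) :
    (toHolomorph hn (inl z)).right = 1 := by
  refine MulAut.freeGroup_ext fun j => ?_
  rw [MulAut.one_apply]
  by_cases hj : n < j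
  · exact fixes_of_mem_closure (π := rightHom.comp (toHolomorph hn))
      (fun i hi => by simp [toHolomorph_gen hn hi]) (Or.inr hj) (inl_mem_of_mem_center hn hz)
  · induction j with
    | zero => exact right_toHolomorph_of_zero hn hz
    | succ j ih =>
      have h := commute_artinAut_of_mem_center hn hz (i := j) (by omega)
      have h1 : Commute (toHolomorph hn (inl z)).right (artinAut j) := by
        simpa using h.map rightHom
      apply (artinAut j).injective
      rw [← MulAut.mul_apply, ← h1.eq, MulAut.mul_apply, artinAut_of_succ, ih (by omega)]

end ExtendedArtin

/-- the euclidean Artin group `Art(Ã_n)` (`n ≥ 2`) has trivial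
center. -/
theorem artinAtilde_center_trivial (n : ℕ) (hn : 2 ≤ n) :
    Subgroup.center (PresentedGroup (relsArtinAtilde n)) = ⊥ := by
  rw [Subgroup.eq_bot_iff_forall]
  intro z hz
  refine SemidirectProduct.inl_injective (φ := zpowersHom _ (shiftAut n)) ?_
  rw [map_one]
  exact (ExtendedArtin.affineData (by omega)).toBraidRel.faithful
    (π := SemidirectProduct.rightHom.comp (ExtendedArtin.toHolomorph hn))
    (fun i hi => by simp [ExtendedArtin.toHolomorph_gen hn hi]) (Nat.zero_le n)
    (ExtendedArtin.inl_mem_of_mem_center hn hz)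
    (ExtendedArtin.right_toHolomorph_of_mem_center hn hz)
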